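/- Let X, Y, Z, A, B, C be random variables whose joint distribution factorizes as P_{XYZABC} = P_A · P_B · P_C · P_{X|BC} · P_{Y|AC} · P_{Z|AB}. Then for every integer s ≥ 1: (−s²/2 − 3s/2 − 2)·(H(X) + H(Y) + H(Z) − H(XY)) + (s²/2 + 3s/2 + 1)·H(XZ) + (s+2)·H(YZ) − (s+1)·H(XYZ) ≥ 0, and the same inequality holds for all permutations of the roles of X, Y and Z. -/

import Mathlib

open Finset
open scoped Classical

/-- Probability that the random variable `X` (on the finite weighted sample space
`(Ω, μ)`) takes the value `b`. -/
noncomputable def pr {Ω β : Type*} [Fintype Ω] (μ : Ω → ℝ) (X : Ω → β) (b : β) : ℝ :=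
  ∑ ω, if X ω = b then μ ω else 0

/-- Shannon entropy of the random variable `X` on the finite weighted sample space
`(Ω, μ)`. -/
noncomputable def ent {Ω β : Type*} [Fintype Ω] [Fintype β] (μ : Ω → ℝ) (X : Ω → β) : ℝ :=
  ∑ b, Real.negMulLog (pr μ X b)

/-- Mutual information `I(X : Y)`. -/
noncomputable def mi {Ω β γ : Type*} [Fintype Ω] [Fintype β] [Fintype γ]
    (μ : Ω → ℝ) (X : Ω → β) (Y : Ω → γ) : ℝ :=
  ent μ X + ent μ Y - ent μ (fun ω => (X ω, Y ω))

/-- Conditional mutual information `I(X : Y | Z)`. -/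
noncomputable def cmi {Ω β γ δ : Type*} [Fintype Ω] [Fintype β] [Fintype γ] [Fintype δ]
    (μ : Ω → ℝ) (X : Ω → β) (Y : Ω → γ) (Z : Ω → δ) : ℝ :=
  ent μ (fun ω => (X ω, Z ω)) + ent μ (fun ω => (Y ω, Z ω)) - ent μ Z
    - ent μ (fun ω => (X ω, Y ω, Z ω))

/-- The Ingleton quantity `I_ING(S,T;U,V)`. -/
noncomputable def ing {Ω β γ δ ε : Type*} [Fintype Ω] [Fintype β] [Fintype γ] [Fintype δ]
    [Fintype ε] (μ : Ω → ℝ) (S : Ω → β) (T : Ω → γ) (U : Ω → δ) (V : Ω → ε) : ℝ :=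
  cmi μ S T U + cmi μ S T V + mi μ U V - mi μ S T

/-- The marginal inequality (15) of Proposition 4, with roles `(P, Q, R)` standing for a
permutation of `(X, Y, Z)`:
`(−s²/2 − 3s/2 − 2)(H(P) + H(Q) + H(R) − H(PQ)) + (s²/2 + 3s/2 + 1)H(PR)
  + (s+2)H(QR) − (s+1)H(PQR) ≥ 0`. -/
def matusMarg2 {Ω β γ δ : Type*} [Fintype Ω] [Fintype β] [Fintype γ] [Fintype δ]
    (s : ℝ) (μ : Ω → ℝ) (P : Ω → β) (Q : Ω → γ) (R : Ω → δ) : Prop :=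
  0 ≤ (-(s ^ 2) / 2 - 3 * s / 2 - 2)
        * (ent μ P + ent μ Q + ent μ R - ent μ (fun ω => (P ω, Q ω)))
    + (s ^ 2 / 2 + 3 * s / 2 + 1) * ent μ (fun ω => (P ω, R ω))
    + (s + 2) * ent μ (fun ω => (Q ω, R ω))
    - (s + 1) * ent μ (fun ω => (P ω, Q ω, R ω))

section Polymatroid

/-- A real function on a meet-semilattice with the Shannon properties of entropy; the meet plays
the role of forming joint random variables. -/
structure IsPolymatroid {L : Type*} [SemilatticeInf L] (f : L → ℝ) : Prop where
  mono : ∀ a b, f a ≤ f (a ⊓ b)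
  subadd : ∀ a b, f (a ⊓ b) ≤ f a + f b
  submod : ∀ a b c, f c + f (a ⊓ b ⊓ c) ≤ f (a ⊓ c) + f (b ⊓ c)

/-- Abstract conditional mutual information `I(a : b | c)`. -/
def condInfo {L : Type*} [SemilatticeInf L] (f : L → ℝ) (a b c : L) : ℝ :=
  f (a ⊓ c) + f (b ⊓ c) - f c - f (a ⊓ b ⊓ c)

/-- Abstract interaction information `I(a : b) - I(a : b | c)`. -/
def interInfo {L : Type*} [SemilatticeInf L] (f : L → ℝ) (a b c : L) : ℝ :=
  f a + f b - f (a ⊓ b) - condInfo f a b c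

variable {L : Type*} [SemilatticeInf L] {f : L → ℝ}

lemma IsPolymatroid.condInfo_nonneg (hf : IsPolymatroid f) (a b c : L) :
    0 ≤ condInfo f a b c := by
  have := hf.submod a b c
  unfold condInfo
  linarith

/-- Bounds for a variable `v` that is independent of `(z, c)` given `(x, y)`. -/
lemma IsPolymatroid.copy_over_xy (hf : IsPolymatroid f) {x y z c v : L}
    (hxy : condInfo f x y c = 0) (hzc : f (z ⊓ c) = f z + f c)
    (hv : condInfo f (z ⊓ c) v (x ⊓ y) = 0) :
    condInfo f x v c ≤ condInfo f x v y ∧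
    condInfo f x c v ≤ condInfo f x y v + condInfo f x c y ∧
    interInfo f x y z
      ≤ condInfo f x y v + condInfo f x v c + condInfo f y v x - condInfo f c v x := by
  have h1 := hf.submod x y (c ⊓ v)
  have h2 := hf.submod c v y
  have h3 := hf.submod z v (x ⊓ y ⊓ c)
  have h4 := hf.submod x y (z ⊓ v)
  have h5 := hf.submod z v y
  have h6 := hf.submod z c v
  have h7 := hf.submod x v (z ⊓ c)
  have h8 := hf.submod z v x
  have h9 := hf.submod y v (x ⊓ z ⊓ c)
  have h10 := hf.submod c v (x ⊓ y ⊓ z)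
  unfold interInfo
  unfold condInfo at *
  simp only [inf_comm, inf_left_comm] at *
  refine ⟨?_, ?_, ?_⟩ <;> linarith

/-- Bounds for a variable `v` that is independent of `(z, y)` given `(x, c)`. -/
lemma IsPolymatroid.copy_over_xc (hf : IsPolymatroid f) {x y z c v : L}
    (hxy : condInfo f x y c = 0) (hzc : f (z ⊓ c) = f z + f c)
    (hv : condInfo f (z ⊓ y) v (x ⊓ c) = 0) :
    condInfo f x v y ≤ condInfo f x c y + condInfo f x v c ∧
    condInfo f x y v ≤ condInfo f x c v ∧
    interInfo f x y z
      ≤ condInfo f x y v + condInfo f x v c + condInfo f c v x - condInfo f y v x := by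
  have h1 := hf.submod x c (y ⊓ v)
  have h2 := hf.submod y v c
  have h3 := hf.submod z v (x ⊓ c ⊓ y)
  have h4 := hf.submod x y (z ⊓ v)
  have h5 := hf.submod z v y
  have h6 := hf.submod z c v
  have h7 := hf.submod x v (z ⊓ c)
  have h8 := hf.submod z v x
  have h9 := hf.submod c v (x ⊓ y ⊓ z)
  have h10 := hf.submod y v (x ⊓ z ⊓ c)
  unfold interInfo
  unfold condInfo at *
  simp only [inf_comm, inf_left_comm] at *
  refine ⟨?_, ?_, ?_⟩ <;> linarith

/-- The entropic form of the factorization over the triangle causal structure. -/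
def IsTriangle (f : L → ℝ) (x y z a b c : L) : Prop :=
  f (x ⊓ y ⊓ z ⊓ a ⊓ b ⊓ c) + f (b ⊓ c) + f (a ⊓ c) + f (a ⊓ b)
    = f a + f b + f c + f (x ⊓ b ⊓ c) + f (y ⊓ a ⊓ c) + f (z ⊓ a ⊓ b)

variable {x y z a b c : L}

lemma IsTriangle.swap_xy (h : IsTriangle f x y z a b c) : IsTriangle f y x z b a c := by
  unfold IsTriangle at *
  simp only [inf_comm, inf_left_comm] at *
  linarith

lemma IsTriangle.swap_yz (h : IsTriangle f x y z a b c) : IsTriangle f x z y a c b := by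
  unfold IsTriangle at *
  simp only [inf_comm, inf_left_comm] at *
  linarith

lemma IsTriangle.condInfo_eq_zero (hf : IsPolymatroid f) (h : IsTriangle f x y z a b c) :
    condInfo f x y c = 0 := by
  refine le_antisymm ?_ (hf.condInfo_nonneg _ _ _)
  have h1 := hf.submod z (x ⊓ y ⊓ c) (a ⊓ b)
  have h2 := hf.submod (x ⊓ b) a (y ⊓ c)
  have h3 := hf.submod y b (x ⊓ c)
  have h4 := hf.subadd b c
  have h5 := hf.subadd a c
  unfold IsTriangle at h
  unfold condInfo
  simp only [inf_comm, inf_left_comm] at *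
  linarith

lemma IsTriangle.indep_hidden (hf : IsPolymatroid f) (h : IsTriangle f x y z a b c) :
    f (z ⊓ b ⊓ c) = f (z ⊓ b) + f c := by
  refine le_antisymm (hf.subadd _ _) ?_
  have h1 := hf.submod x (y ⊓ z ⊓ a) (b ⊓ c)
  have h2 := hf.submod y (z ⊓ b) (a ⊓ c)
  have h3 := hf.submod c a (z ⊓ b)
  have h4 := hf.subadd a b
  unfold IsTriangle at h
  simp only [inf_comm, inf_left_comm] at *
  linarith

lemma IsTriangle.indep (hf : IsPolymatroid f) (h : IsTriangle f x y z a b c) :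
    f (z ⊓ c) = f z + f c := by
  refine le_antisymm (hf.subadd _ _) ?_
  have h1 := h.indep_hidden hf
  have h2 := hf.submod b c z
  simp only [inf_comm, inf_left_comm] at *
  linarith

lemma IsTriangle.interInfo_le (hf : IsPolymatroid f) (h : IsTriangle f x y z a b c) :
    interInfo f x y z ≤ (f (y ⊓ c ⊓ z) - f (c ⊓ z)) + condInfo f z c y
      + ((f (x ⊓ c ⊓ z) - f (c ⊓ z)) + condInfo f z c x) := by
  have e1 := h.condInfo_eq_zero hf
  have e2 := h.indep hf
  have e3 := h.indep_hidden hf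
  have e4 := h.swap_yz.condInfo_eq_zero hf
  have e5 := h.swap_yz.indep hf
  have h1 := hf.submod b y z
  have h2 := hf.submod b y x
  have h3 := hf.submod c b (x ⊓ y ⊓ z)
  have h4 := hf.submod y x (z ⊓ c)
  have h5 := hf.submod z x (y ⊓ b)
  have h6 := hf.submod b x z
  have h7 := hf.submod x y (z ⊓ b ⊓ c)
  have h8 := hf.mono (y ⊓ z ⊓ b ⊓ c) x
  have h9 := hf.mono (x ⊓ z ⊓ b ⊓ c) y
  have h10 := hf.submod z c x
  have h11 := hf.submod z c y
  unfold interInfo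
  unfold condInfo at *
  simp only [inf_comm, inf_left_comm] at *
  linarith

/-- The marginal inequality follows from the conditional Matúš inequality for `(x, y, c, z)`. -/
lemma IsTriangle.marginal_of_matus (hf : IsPolymatroid f) (h : IsTriangle f x y z a b c)
    {s : ℝ} (hs : 1 ≤ s)
    (hM : s * interInfo f x y z ≤ s * (s + 1) / 2 * condInfo f x c y + condInfo f y c x) :
    0 ≤ (-(s ^ 2) / 2 - 3 * s / 2 - 2) * (f x + f y + f z - f (x ⊓ y))
      + (s ^ 2 / 2 + 3 * s / 2 + 1) * f (x ⊓ z) + (s + 2) * f (y ⊓ z)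
      - (s + 1) * f (x ⊓ y ⊓ z) := by
  have e1 := h.condInfo_eq_zero hf
  have e2 := h.indep hf
  have hI := h.interInfo_le hf
  have hnn : 0 ≤ (f (x ⊓ c ⊓ z) - f (c ⊓ z)) + condInfo f z c x := by
    have h1 := hf.mono (c ⊓ z) x
    have h2 := hf.condInfo_nonneg z c x
    simp only [inf_comm, inf_left_comm] at *
    linarith
  have hk : 0 ≤ (s * (s + 1) / 2 - 1) * ((f (x ⊓ c ⊓ z) - f (c ⊓ z)) + condInfo f z c x) :=
    mul_nonneg (by nlinarith) hnn
  have ht : f (x ⊓ y) + f (x ⊓ z) - f x - f y - f z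
      = (f (x ⊓ c ⊓ z) - f (c ⊓ z)) + condInfo f z c x + condInfo f x c y := by
    unfold condInfo at *
    simp only [inf_comm, inf_left_comm] at *
    linarith
  have hy : f (x ⊓ y) + f (y ⊓ z) - f x - f y - f z
      = (f (y ⊓ c ⊓ z) - f (c ⊓ z)) + condInfo f z c y + condInfo f y c x := by
    unfold condInfo at *
    simp only [inf_comm, inf_left_comm] at *
    linarith
  have hJ : interInfo f x y z
      = f x + f y - f (x ⊓ y) - (f (x ⊓ z) + f (y ⊓ z) - f z - f (x ⊓ y ⊓ z)) := rfl
  have key : (-(s ^ 2) / 2 - 3 * s / 2 - 2) * (f x + f y + f z - f (x ⊓ y))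
      + (s ^ 2 / 2 + 3 * s / 2 + 1) * f (x ⊓ z) + (s + 2) * f (y ⊓ z)
      - (s + 1) * f (x ⊓ y ⊓ z)
      = (f (x ⊓ y) + f (y ⊓ z) - f x - f y - f z)
        + s * (s + 1) / 2 * (f (x ⊓ y) + f (x ⊓ z) - f x - f y - f z)
        - (s + 1) * interInfo f x y z := by
    rw [hJ]; ring
  rw [key, ht, hy]
  linarith

end Polymatroid

section Entropy

variable {Ω : Type*} [Fintype Ω]

/-- The mass of the equivalence class of `ω`. -/
noncomputable def classMass (μ : Ω → ℝ) (r : Setoid Ω) (ω : Ω) : ℝ :=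
  ∑ ω', if r ω' ω then μ ω' else 0

/-- The entropy of the partition into equivalence classes. -/
noncomputable def partEnt (μ : Ω → ℝ) (r : Setoid Ω) : ℝ :=
  -∑ ω, μ ω * Real.log (classMass μ r ω)

lemma sum_pr_mul {β : Type*} [Fintype β] (μ : Ω → ℝ) (X : Ω → β) (g : β → ℝ) :
    ∑ b, pr μ X b * g b = ∑ ω, μ ω * g (X ω) := by
  simp only [pr, Finset.sum_mul, ite_mul, zero_mul]
  rw [Finset.sum_comm]
  simp

lemma pr_apply_eq_classMass {β : Type*} (μ : Ω → ℝ) (X : Ω → β) (ω : Ω) :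
    pr μ X (X ω) = classMass μ (Setoid.ker X) ω := rfl

lemma ent_eq_partEnt {β : Type*} [Fintype β] (μ : Ω → ℝ) (X : Ω → β) :
    ent μ X = partEnt μ (Setoid.ker X) := by
  have h := sum_pr_mul μ X (fun b => Real.log (pr μ X b))
  simp only [pr_apply_eq_classMass] at h
  simp only [ent, partEnt, Real.negMulLog, neg_mul, Finset.sum_neg_distrib, h]

lemma ker_prodMk {α β γ : Type*} (X : α → β) (Y : α → γ) :
    Setoid.ker (fun a => (X a, Y a)) = Setoid.ker X ⊓ Setoid.ker Y := by
  ext a b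
  simp [Setoid.ker_def, Setoid.inf_def]

lemma ker_quotient_mk {α : Type*} (r : Setoid α) : Setoid.ker (Quotient.mk r) = r :=
  Setoid.ker_mk_eq r

section Nonneg

variable {μ : Ω → ℝ}

lemma classMass_mono (hμ : ∀ ω, 0 ≤ μ ω) {r t : Setoid Ω} (h : r ≤ t) (ω : Ω) :
    classMass μ r ω ≤ classMass μ t ω := by
  refine Finset.sum_le_sum fun ω' _ => ?_
  by_cases h1 : r ω' ω
  · simp [h1, h h1]
  · simp only [h1, if_false]
    split_ifs <;> simp [hμ]

lemma le_classMass (hμ : ∀ ω, 0 ≤ μ ω) (r : Setoid Ω) (ω : Ω) : μ ω ≤ classMass μ r ω := by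
  have h := Finset.single_le_sum (f := fun ω' => if r ω' ω then μ ω' else 0)
    (fun i _ => by split_ifs <;> simp [hμ]) (Finset.mem_univ ω)
  simpa [classMass, r.refl' ω] using h

lemma classMass_pos (hμ : ∀ ω, 0 ≤ μ ω) (r : Setoid Ω) {ω : Ω} (h : μ ω ≠ 0) :
    0 < classMass μ r ω :=
  ((hμ ω).lt_of_ne' h).trans_le (le_classMass hμ r ω)

lemma partEnt_antitone (hμ : ∀ ω, 0 ≤ μ ω) {r t : Setoid Ω} (h : r ≤ t) :
    partEnt μ t ≤ partEnt μ r := by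
  refine neg_le_neg (Finset.sum_le_sum fun ω _ => ?_)
  by_cases h0 : μ ω = 0
  · simp [h0]
  · exact mul_le_mul_of_nonneg_left
      (Real.log_le_log (classMass_pos hμ r h0) (classMass_mono hμ h ω)) (hμ ω)

lemma pr_nonneg {β : Type*} (hμ : ∀ ω, 0 ≤ μ ω) (X : Ω → β) (b : β) : 0 ≤ pr μ X b :=
  Finset.sum_nonneg fun ω _ => by split_ifs <;> simp [hμ]

end Nonneg

/-- Marginalization over the first component of a pair. -/
lemma sum_pr_pair {β γ : Type*} [Fintype β] (μ : Ω → ℝ) (X : Ω → β) (Z : Ω → γ) (z : γ) :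
    ∑ x, pr μ (fun ω => (X ω, Z ω)) (x, z) = pr μ Z z := by
  simp only [pr, Prod.mk.injEq, ite_and]
  rw [Finset.sum_comm]
  simp

lemma sub_le_mul_log {p q : ℝ} (hp : 0 < p) (hq : 0 < q) :
    p - q ≤ p * (Real.log p - Real.log q) := by
  have h := Real.log_le_sub_one_of_pos (div_pos hq hp)
  rw [Real.log_div hq.ne' hp.ne'] at h
  have h2 := mul_le_mul_of_nonneg_left h hp.le
  have h3 : p * (q / p - 1) = q - p := by field_simp
  linarith

lemma partEnt_submod {μ : Ω → ℝ} (hμ : ∀ ω, 0 ≤ μ ω) (a b c : Setoid Ω) :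
    partEnt μ c + partEnt μ (a ⊓ b ⊓ c) ≤ partEnt μ (a ⊓ c) + partEnt μ (b ⊓ c) := by
  -- `W` is the joint variable, with values in a product of quotients
  let W : Ω → Quotient a × Quotient b × Quotient c :=
    fun ω => (Quotient.mk a ω, Quotient.mk b ω, Quotient.mk c ω)
  let pac : Quotient a × Quotient c → ℝ := pr μ fun ω => (Quotient.mk a ω, Quotient.mk c ω)
  let pbc : Quotient b × Quotient c → ℝ := pr μ fun ω => (Quotient.mk b ω, Quotient.mk c ω)
  let pc : Quotient c → ℝ := pr μ (Quotient.mk c)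
  let q : Quotient a × Quotient b × Quotient c → ℝ :=
    fun w => pac (w.1, w.2.2) * pbc (w.2.1, w.2.2) / pc w.2.2
  have hq0 : ∀ w, 0 ≤ q w := fun w =>
    div_nonneg (mul_nonneg (pr_nonneg hμ _ _) (pr_nonneg hμ _ _)) (pr_nonneg hμ _ _)
  have hac : ∀ z, ∑ x, pac (x, z) = pc z := sum_pr_pair μ _ _
  have hbc : ∀ z, ∑ y, pbc (y, z) = pc z := sum_pr_pair μ _ _
  have hqsum : ∑ w, q w = ∑ w, pr μ W w := by
    have h1 : ∑ w, pr μ W w = ∑ ω, μ ω := by simpa using sum_pr_mul μ W (fun _ => 1)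
    have h2 : ∑ z, pc z = ∑ ω, μ ω := by simpa using sum_pr_mul μ (Quotient.mk c) (fun _ => 1)
    rw [h1, ← h2, Fintype.sum_prod_type]
    simp_rw [Fintype.sum_prod_type]
    rw [Finset.sum_congr rfl fun x _ => Finset.sum_comm, Finset.sum_comm]
    refine Finset.sum_congr rfl fun z _ => ?_
    simp only [q, ← Finset.sum_div, ← Finset.mul_sum, ← Finset.sum_mul, hac, hbc]
    by_cases hz : pc z = 0
    · simp [hz]
    · field_simp
  have key : ∑ w, (pr μ W w - q w) ≤ ∑ w, pr μ W w * (Real.log (pr μ W w) + Real.log (pc w.2.2)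
      - Real.log (pac (w.1, w.2.2)) - Real.log (pbc (w.2.1, w.2.2))) := by
    refine Finset.sum_le_sum fun w _ => ?_
    rcases (pr_nonneg hμ W w).eq_or_lt with h0 | hpos
    · rw [← h0]; simpa using hq0 w
    · obtain ⟨ω, -, hω⟩ := Finset.exists_ne_zero_of_sum_ne_zero hpos.ne'
      have hW : W ω = w := by by_contra h; simp [h] at hω
      have hω0 : μ ω ≠ 0 := by simpa [hW] using hω
      subst hW
      have h1 : 0 < pac ((W ω).1, (W ω).2.2) := classMass_pos hμ (Setoid.ker _) hω0
      have h2 : 0 < pbc ((W ω).2.1, (W ω).2.2) := classMass_pos hμ (Setoid.ker _) hω0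
      have h3 : 0 < pc (W ω).2.2 := classMass_pos hμ (Setoid.ker _) hω0
      have := sub_le_mul_log hpos (div_pos (mul_pos h1 h2) h3)
      rw [Real.log_div (mul_pos h1 h2).ne' h3.ne', Real.log_mul h1.ne' h2.ne'] at this
      refine this.trans (le_of_eq ?_)
      ring
  rw [Finset.sum_sub_distrib, hqsum, sub_self, sum_pr_mul μ W] at key
  have e1 : ∀ ω, pr μ W (W ω) = classMass μ (a ⊓ b ⊓ c) ω := fun ω => by
    rw [pr_apply_eq_classMass, ker_prodMk, ker_prodMk, ker_quotient_mk, ker_quotient_mk,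
      ker_quotient_mk, inf_assoc]
  have e2 : ∀ ω, pac ((W ω).1, (W ω).2.2) = classMass μ (a ⊓ c) ω := fun ω => by
    have := pr_apply_eq_classMass μ (fun ω => (Quotient.mk a ω, Quotient.mk c ω)) ω
    rwa [ker_prodMk, ker_quotient_mk, ker_quotient_mk] at this
  have e3 : ∀ ω, pbc ((W ω).2.1, (W ω).2.2) = classMass μ (b ⊓ c) ω := fun ω => by
    have := pr_apply_eq_classMass μ (fun ω => (Quotient.mk b ω, Quotient.mk c ω)) ω
    rwa [ker_prodMk, ker_quotient_mk, ker_quotient_mk] at this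
  have e4 : ∀ ω, pc (W ω).2.2 = classMass μ c ω := fun ω => by
    have := pr_apply_eq_classMass μ (Quotient.mk c) ω
    rwa [ker_quotient_mk] at this
  simp only [e1, e2, e3, e4, mul_sub, mul_add, Finset.sum_sub_distrib,
    Finset.sum_add_distrib] at key
  unfold partEnt
  linarith

lemma isPolymatroid_partEnt {μ : Ω → ℝ} (hμ : ∀ ω, 0 ≤ μ ω) (hμ1 : ∑ ω, μ ω = 1) :
    IsPolymatroid (partEnt μ) where
  mono a b := partEnt_antitone hμ inf_le_left
  subadd a b := by
    have h := partEnt_submod hμ a b ⊤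
    have ht : partEnt μ ⊤ = 0 := by simp [partEnt, classMass, Setoid.top_def, hμ1]
    simpa [ht] using h
  submod := partEnt_submod hμ

end Entropy

section Copy

variable {Ω Γ : Type*} [Fintype Γ]

/-- `ν` is a weighting of `Ω × Γ` whose first marginal is `μ`. -/
structure IsExtension (μ : Ω → ℝ) (ν : Ω × Γ → ℝ) : Prop where
  nonneg : ∀ p, 0 ≤ ν p
  marginal : ∀ ω, ∑ v, ν (ω, v) = μ ω

namespace IsExtension

variable {μ : Ω → ℝ} {ν : Ω × Γ → ℝ}

lemma base_nonneg (h : IsExtension μ ν) (ω : Ω) : 0 ≤ μ ω :=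
  h.marginal ω ▸ Finset.sum_nonneg fun _ _ => h.nonneg _

lemma le_base (h : IsExtension μ ν) (ω : Ω) (v : Γ) : ν (ω, v) ≤ μ ω :=
  h.marginal ω ▸ Finset.single_le_sum (f := fun v => ν (ω, v)) (fun _ _ => h.nonneg _)
    (Finset.mem_univ v)

end IsExtension

/-- The weighting of `Ω × Γ` in which the second coordinate is the variable `C`. -/
noncomputable def graphExt (μ : Ω → ℝ) (C : Ω → Γ) : Ω × Γ → ℝ :=
  fun p => if C p.1 = p.2 then μ p.1 else 0

lemma isExtension_graphExt {μ : Ω → ℝ} (hμ : ∀ ω, 0 ≤ μ ω) (C : Ω → Γ) :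
    IsExtension μ (graphExt μ C) where
  nonneg p := by unfold graphExt; split_ifs <;> simp [hμ]
  marginal ω := by simp [graphExt]

variable [Fintype Ω]

/-- A variable on `Ω`, seen on `Ω × Γ`. -/
def liftFst (Γ : Type*) (r : Setoid Ω) : Setoid (Ω × Γ) := r.comap Prod.fst

/-- The variable on `Ω × Γ` given by the second coordinate. -/
def sndKer (Ω Γ : Type*) : Setoid (Ω × Γ) := Setoid.ker Prod.snd

lemma sum_classMass_mul (ρ τ : Ω → ℝ) (k : Setoid Ω) :
    ∑ ω, ρ ω * classMass τ k ω = ∑ ω, τ ω * classMass ρ k ω := by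
  simp only [classMass, Finset.mul_sum, mul_ite, mul_zero]
  rw [Finset.sum_comm]
  refine Finset.sum_congr rfl fun ω _ => Finset.sum_congr rfl fun ω' _ => ?_
  simp only [k.comm' (x := ω) (y := ω'), mul_comm]

lemma classMass_congr (μ : Ω → ℝ) {k r : Setoid Ω} (h : k ≤ r) {ω ω' : Ω} (hω : k ω ω') :
    classMass μ r ω = classMass μ r ω' := by
  refine Finset.sum_congr rfl fun τ _ => ?_
  have : r τ ω ↔ r τ ω' := ⟨fun hτ => r.trans' hτ (h hω), fun hτ => r.trans' hτ (r.symm' (h hω))⟩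
  simp only [this]

lemma classMass_liftFst_inf (ν : Ω × Γ → ℝ) (r : Setoid Ω) (p : Ω × Γ) :
    classMass ν (liftFst Γ r ⊓ sndKer Ω Γ) p = classMass (fun ω => ν (ω, p.2)) r p.1 := by
  have h : ∀ q : Ω × Γ, (liftFst Γ r ⊓ sndKer Ω Γ) q p ↔ r q.1 p.1 ∧ q.2 = p.2 := fun q => Iff.rfl
  simp only [classMass, h, Fintype.sum_prod_type, ite_and]
  refine Finset.sum_congr rfl fun ω _ => ?_
  split_ifs <;> simp

lemma partEnt_sndKer (ν : Ω × Γ → ℝ) :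
    partEnt ν (sndKer Ω Γ) = partEnt ν (liftFst Γ ⊤ ⊓ sndKer Ω Γ) := by
  congr 1
  ext p q
  exact ⟨fun h => ⟨trivial, h⟩, fun h => h.2⟩

namespace IsExtension

variable {μ : Ω → ℝ} {ν : Ω × Γ → ℝ}

lemma sum_eq (h : IsExtension μ ν) : ∑ p, ν p = ∑ ω, μ ω := by
  simp [Fintype.sum_prod_type, h.marginal]

lemma classMass_liftFst (h : IsExtension μ ν) (r : Setoid Ω) (p : Ω × Γ) :
    classMass ν (liftFst Γ r) p = classMass μ r p.1 := by
  have hr : ∀ q : Ω × Γ, liftFst Γ r q p ↔ r q.1 p.1 := fun q => Iff.rfl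
  simp only [classMass, hr, Fintype.sum_prod_type, ← h.marginal]
  refine Finset.sum_congr rfl fun ω _ => ?_
  split_ifs <;> simp

lemma partEnt_liftFst (h : IsExtension μ ν) (r : Setoid Ω) :
    partEnt ν (liftFst Γ r) = partEnt μ r := by
  simp only [partEnt, h.classMass_liftFst, Fintype.sum_prod_type, ← Finset.sum_mul, h.marginal]

lemma condInfo_liftFst (h : IsExtension μ ν) (a b c : Setoid Ω) :
    condInfo (partEnt ν) (liftFst Γ a) (liftFst Γ b) (liftFst Γ c)
      = condInfo (partEnt μ) a b c := by
  simp only [condInfo, ← h.partEnt_liftFst]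
  rfl

lemma interInfo_liftFst (h : IsExtension μ ν) (a b c : Setoid Ω) :
    interInfo (partEnt ν) (liftFst Γ a) (liftFst Γ b) (liftFst Γ c)
      = interInfo (partEnt μ) a b c := by
  simp only [interInfo, condInfo, ← h.partEnt_liftFst]
  rfl

end IsExtension

/-- Resample the second coordinate conditionally on the class of the first one. -/
noncomputable def copyOver (μ : Ω → ℝ) (k : Setoid Ω) (ν : Ω × Γ → ℝ) : Ω × Γ → ℝ :=
  fun p => μ p.1 * (classMass (fun ω => ν (ω, p.2)) k p.1 / classMass μ k p.1)

namespace IsExtension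

variable {μ : Ω → ℝ} {ν : Ω × Γ → ℝ}

lemma copyOver (h : IsExtension μ ν) (k : Setoid Ω) : IsExtension μ (copyOver μ k ν) where
  nonneg p := by
    refine mul_nonneg (h.base_nonneg _) (div_nonneg ?_ ?_) <;>
      exact Finset.sum_nonneg fun ω _ => by split_ifs <;> simp [h.nonneg, h.base_nonneg]
  marginal ω := by
    have hs : ∑ v, classMass (fun ω => ν (ω, v)) k ω = classMass μ k ω := by
      simp only [classMass, ← h.marginal]
      rw [Finset.sum_comm]
      refine Finset.sum_congr rfl fun ω' _ => ?_
      split_ifs <;> simp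
    simp only [_root_.copyOver, ← Finset.mul_sum, ← Finset.sum_div, hs]
    by_cases h0 : μ ω = 0
    · simp [h0]
    · rw [div_self (classMass_pos h.base_nonneg k h0).ne', mul_one]

lemma sum_copyOver_mul (h : IsExtension μ ν) (k : Setoid Ω) (v : Γ) (g : Ω → ℝ)
    (hg : ∀ ω ω', k ω ω' → g ω = g ω') :
    ∑ ω, _root_.copyOver μ k ν (ω, v) * g ω = ∑ ω, ν (ω, v) * g ω := by
  have h1 := sum_classMass_mul (fun ω => μ ω * (g ω / classMass μ k ω)) (fun ω => ν (ω, v)) k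
  have h2 : ∀ ω, classMass (fun ω => μ ω * (g ω / classMass μ k ω)) k ω
      = classMass μ k ω * (g ω / classMass μ k ω) := fun ω => by
    simp only [classMass, Finset.sum_mul]
    refine Finset.sum_congr rfl fun ω' _ => ?_
    split_ifs with hω
    · rw [hg _ _ hω]
      congr 2
      exact classMass_congr μ le_rfl hω
    · simp
  calc ∑ ω, _root_.copyOver μ k ν (ω, v) * g ω
      = ∑ ω, μ ω * (g ω / classMass μ k ω) * classMass (fun ω => ν (ω, v)) k ω :=
        Finset.sum_congr rfl fun ω _ => by simp only [_root_.copyOver]; ring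
    _ = ∑ ω, ν (ω, v) * (classMass μ k ω * (g ω / classMass μ k ω)) := by
        rw [h1]; simp only [h2]
    _ = ∑ ω, ν (ω, v) * g ω := by
        refine Finset.sum_congr rfl fun ω _ => ?_
        by_cases h0 : μ ω = 0
        · have : ν (ω, v) = 0 := le_antisymm (h0 ▸ h.le_base ω v) (h.nonneg _)
          simp [this]
        · rw [mul_div_cancel₀ _ (classMass_pos h.base_nonneg k h0).ne']

/-- The copy has the same joint law with the variables it is resampled over. -/
lemma partEnt_copyOver (h : IsExtension μ ν) {k r : Setoid Ω} (hkr : k ≤ r) :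
    partEnt (_root_.copyOver μ k ν) (liftFst Γ r ⊓ sndKer Ω Γ)
      = partEnt ν (liftFst Γ r ⊓ sndKer Ω Γ) := by
  have hm : ∀ (v : Γ) (ω : Ω), classMass (fun ω => _root_.copyOver μ k ν (ω, v)) r ω
      = classMass (fun ω => ν (ω, v)) r ω := fun v ω => by
    have := h.sum_copyOver_mul k v (fun ω' => if r ω' ω then 1 else 0) fun a b hab => by
      have : r a ω ↔ r b ω :=
        ⟨fun ha => r.trans' (r.symm' (hkr hab)) ha, fun hb => r.trans' (hkr hab) hb⟩
      simp only [this]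
    simpa only [classMass, mul_ite, mul_one, mul_zero] using this
  simp only [partEnt, classMass_liftFst_inf, Fintype.sum_prod_type_right, hm]
  congr 1
  exact Finset.sum_congr rfl fun v _ => h.sum_copyOver_mul k v _ fun a b hab => by
    rw [classMass_congr _ hkr hab]

/-- The copy is independent of everything on `Ω`, given the variables it is resampled over. -/
lemma condInfo_copyOver (h : IsExtension μ ν) (k r : Setoid Ω) :
    condInfo (partEnt (_root_.copyOver μ k ν)) (liftFst Γ r) (sndKer Ω Γ) (liftFst Γ k) = 0 := by
  have hc := h.copyOver k
  have e1 : liftFst Γ r ⊓ liftFst Γ k = liftFst Γ (r ⊓ k) := rfl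
  have e2 : liftFst Γ r ⊓ sndKer Ω Γ ⊓ liftFst Γ k = liftFst Γ (r ⊓ k) ⊓ sndKer Ω Γ := by
    rw [← e1, inf_right_comm]
  have hm : ∀ (t : Setoid Ω), t ≤ k → ∀ p : Ω × Γ,
      classMass (_root_.copyOver μ k ν) (liftFst Γ t ⊓ sndKer Ω Γ) p
      = classMass μ t p.1
        * (classMass (fun ω => ν (ω, p.2)) k p.1 / classMass μ k p.1) := fun t ht p => by
    rw [classMass_liftFst_inf]
    simp only [classMass, Finset.sum_mul]
    refine Finset.sum_congr rfl fun ω _ => ?_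
    split_ifs with hω
    · simp only [_root_.copyOver]
      rw [classMass_congr μ le_rfl (ht hω), classMass_congr _ le_rfl (ht hω)]
      rfl
    · simp
  rw [condInfo, e1, e2, inf_comm (sndKer Ω Γ)]
  simp only [partEnt, ← Finset.sum_neg_distrib, ← Finset.sum_add_distrib,
    ← Finset.sum_sub_distrib]
  refine Finset.sum_eq_zero fun p _ => ?_
  rw [hm k le_rfl, hm (r ⊓ k) inf_le_right, hc.classMass_liftFst, hc.classMass_liftFst]
  by_cases h0 : _root_.copyOver μ k ν p = 0
  · simp [h0]
  · have hμ0 : μ p.1 ≠ 0 := left_ne_zero_of_mul h0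
    have hκ := right_ne_zero_of_mul h0
    rw [Real.log_mul (classMass_pos h.base_nonneg k hμ0).ne' hκ,
      Real.log_mul (classMass_pos h.base_nonneg _ hμ0).ne' hκ]
    ring

variable {k a b : Setoid Ω}

lemma condInfo_copyOver_given (h : IsExtension μ ν) (ha : k ≤ a) (hb : k ≤ b) :
    condInfo (partEnt (_root_.copyOver μ k ν)) (liftFst Γ a) (liftFst Γ b) (sndKer Ω Γ)
      = condInfo (partEnt ν) (liftFst Γ a) (liftFst Γ b) (sndKer Ω Γ) := by
  have e : liftFst Γ a ⊓ liftFst Γ b = liftFst Γ (a ⊓ b) := rfl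
  simp only [condInfo, e, partEnt_sndKer, h.partEnt_copyOver ha, h.partEnt_copyOver hb,
    h.partEnt_copyOver (le_inf ha hb), h.partEnt_copyOver le_top]

lemma condInfo_copyOver_left (h : IsExtension μ ν) (ha : k ≤ a) (hb : k ≤ b) :
    condInfo (partEnt (_root_.copyOver μ k ν)) (liftFst Γ a) (sndKer Ω Γ) (liftFst Γ b)
      = condInfo (partEnt ν) (liftFst Γ a) (sndKer Ω Γ) (liftFst Γ b) := by
  have e : liftFst Γ a ⊓ liftFst Γ b = liftFst Γ (a ⊓ b) := rfl
  simp only [condInfo, inf_right_comm _ (sndKer Ω Γ), inf_comm (sndKer Ω Γ), e,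
    h.partEnt_copyOver hb, h.partEnt_copyOver (le_inf ha hb), h.partEnt_liftFst,
    (h.copyOver k).partEnt_liftFst]

end IsExtension

lemma partEnt_graphExt (μ : Ω → ℝ) (C : Ω → Γ) (r : Setoid Ω) :
    partEnt (graphExt μ C) (liftFst Γ r ⊓ sndKer Ω Γ) = partEnt μ (r ⊓ Setoid.ker C) := by
  have hm : ∀ ω, classMass (fun ω' => graphExt μ C (ω', C ω)) r ω
      = classMass μ (r ⊓ Setoid.ker C) ω := fun ω => by
    refine Finset.sum_congr rfl fun ω' _ => ?_
    have : (r ⊓ Setoid.ker C) ω' ω ↔ r ω' ω ∧ C ω' = C ω := Iff.rfl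
    simp only [graphExt, this, ite_and]
  simp only [partEnt, classMass_liftFst_inf, Fintype.sum_prod_type, ← hm]
  congr 1
  refine Finset.sum_congr rfl fun ω _ => ?_
  rw [Finset.sum_eq_single (C ω)]
  · simp [graphExt]
  · intro v _ hv
    simp [graphExt, hv.symm]
  · simp

end Copy

section Matus

variable {Ω Γ : Type*} [Fintype Ω] [Fintype Γ]

/-- An auxiliary variable obtained from `c` by `m` rounds of copying over `(x, y)` and then over
`(x, c)`. -/
def EvenState (Γ : Type*) [Fintype Γ] (μ : Ω → ℝ) (x y z c : Setoid Ω) (m : ℕ) : Prop :=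
  ∃ ν : Ω × Γ → ℝ, IsExtension μ ν ∧
    condInfo (partEnt ν) (liftFst Γ x) (liftFst Γ y) (sndKer Ω Γ)
      ≤ m * condInfo (partEnt μ) x c y ∧
    condInfo (partEnt ν) (liftFst Γ x) (sndKer Ω Γ) (liftFst Γ y)
      ≤ (m + 1) * condInfo (partEnt μ) x c y ∧
    2 * m * interInfo (partEnt μ) x y z
        + condInfo (partEnt ν) (liftFst Γ y) (sndKer Ω Γ) (liftFst Γ x)
      ≤ m * (2 * m + 1) * condInfo (partEnt μ) x c y + condInfo (partEnt μ) y c x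

/-- An auxiliary variable obtained from `c` by `m` rounds of copying over `(x, y)` and then over
`(x, c)`, followed by one more copy over `(x, y)`. -/
def OddState (Γ : Type*) [Fintype Γ] (μ : Ω → ℝ) (x y z c : Setoid Ω) (m : ℕ) : Prop :=
  ∃ ν : Ω × Γ → ℝ, IsExtension μ ν ∧
    condInfo (partEnt ν) (liftFst Γ x) (liftFst Γ c) (sndKer Ω Γ)
      ≤ (m + 1) * condInfo (partEnt μ) x c y ∧
    condInfo (partEnt ν) (liftFst Γ x) (sndKer Ω Γ) (liftFst Γ c)
      ≤ (m + 1) * condInfo (partEnt μ) x c y ∧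
    (2 * m + 1) * interInfo (partEnt μ) x y z
        + condInfo (partEnt ν) (liftFst Γ c) (sndKer Ω Γ) (liftFst Γ x)
      ≤ (m + 1) * (2 * m + 1) * condInfo (partEnt μ) x c y + condInfo (partEnt μ) y c x

variable {μ : Ω → ℝ} {x y z c : Setoid Ω}

lemma EvenState.odd (hμ1 : ∑ ω, μ ω = 1) (hxy : condInfo (partEnt μ) x y c = 0)
    (hzc : partEnt μ (z ⊓ c) = partEnt μ z + partEnt μ c) {m : ℕ}
    (h : EvenState Γ μ x y z c m) : OddState Γ μ x y z c m := by
  obtain ⟨ν, hν, h1, h2, h3⟩ := h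
  have hc := hν.copyOver (x ⊓ y)
  have hx : x ⊓ y ≤ x := inf_le_left
  have hy : x ⊓ y ≤ y := inf_le_right
  have hp := isPolymatroid_partEnt hc.nonneg (hc.sum_eq.trans hμ1)
  obtain ⟨s1, s2, s3⟩ := hp.copy_over_xy (x := liftFst Γ x) (y := liftFst Γ y)
    (z := liftFst Γ z) (c := liftFst Γ c) (v := sndKer Ω Γ)
    (by rwa [hc.condInfo_liftFst])
    (by simp only [hc.partEnt_liftFst, ← hzc]; exact hc.partEnt_liftFst (z ⊓ c))
    (hν.condInfo_copyOver (x ⊓ y) (z ⊓ c))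
  rw [hν.condInfo_copyOver_left hx hy] at s1
  rw [hν.condInfo_copyOver_given hx hy, hc.condInfo_liftFst] at s2
  rw [hν.condInfo_copyOver_given hx hy, hν.condInfo_copyOver_left hy hx,
    hc.interInfo_liftFst] at s3
  exact ⟨_, hc, by linarith, by linarith, by linarith⟩

lemma OddState.even (hμ1 : ∑ ω, μ ω = 1) (hxy : condInfo (partEnt μ) x y c = 0)
    (hzc : partEnt μ (z ⊓ c) = partEnt μ z + partEnt μ c) {m : ℕ}
    (h : OddState Γ μ x y z c m) : EvenState Γ μ x y z c (m + 1) := by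
  obtain ⟨ν, hν, h1, h2, h3⟩ := h
  have hc := hν.copyOver (x ⊓ c)
  have hx : x ⊓ c ≤ x := inf_le_left
  have hc' : x ⊓ c ≤ c := inf_le_right
  have hp := isPolymatroid_partEnt hc.nonneg (hc.sum_eq.trans hμ1)
  obtain ⟨s1, s2, s3⟩ := hp.copy_over_xc (x := liftFst Γ x) (y := liftFst Γ y)
    (z := liftFst Γ z) (c := liftFst Γ c) (v := sndKer Ω Γ)
    (by rwa [hc.condInfo_liftFst])
    (by simp only [hc.partEnt_liftFst, ← hzc]; exact hc.partEnt_liftFst (z ⊓ c))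
    (hν.condInfo_copyOver (x ⊓ c) (z ⊓ y))
  rw [hν.condInfo_copyOver_left hx hc', hc.condInfo_liftFst] at s1
  rw [hν.condInfo_copyOver_given hx hc'] at s2
  rw [hν.condInfo_copyOver_left hx hc', hν.condInfo_copyOver_left hc' hx,
    hc.interInfo_liftFst] at s3
  refine ⟨_, hc, ?_, ?_, ?_⟩ <;> push_cast <;> linarith

lemma evenState_zero (hμ : ∀ ω, 0 ≤ μ ω) (C : Ω → Γ)
    (hxy : condInfo (partEnt μ) x y (Setoid.ker C) = 0) :
    EvenState Γ μ x y z (Setoid.ker C) 0 := by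
  have hν := isExtension_graphExt hμ C
  have e : ∀ a b : Setoid Ω, liftFst Γ a ⊓ liftFst Γ b = liftFst Γ (a ⊓ b) := fun _ _ => rfl
  have hg : ∀ a b : Setoid Ω,
      condInfo (partEnt (graphExt μ C)) (liftFst Γ a) (sndKer Ω Γ) (liftFst Γ b)
        = condInfo (partEnt μ) a (Setoid.ker C) b := fun a b => by
    simp only [condInfo, inf_right_comm _ (sndKer Ω Γ), inf_comm (sndKer Ω Γ), e,
      partEnt_graphExt, hν.partEnt_liftFst, inf_right_comm _ (Setoid.ker C),
      inf_comm (Setoid.ker C)]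
  refine ⟨_, hν, le_of_eq ?_, le_of_eq ?_, le_of_eq ?_⟩
  · simp only [condInfo, e, partEnt_sndKer, partEnt_graphExt, top_inf_eq] at hxy ⊢
    simpa using hxy
  · simp [hg]
  · simp [hg]

/-- Matúš's inequality for `(x, y, c, z)` when `x` and `y` are independent given `c` and `z` is
independent of `c`. -/
theorem matus_inequality (hμ : ∀ ω, 0 ≤ μ ω) (hμ1 : ∑ ω, μ ω = 1) (C : Ω → Γ)
    (hxy : condInfo (partEnt μ) x y (Setoid.ker C) = 0)
    (hzc : partEnt μ (z ⊓ Setoid.ker C) = partEnt μ z + partEnt μ (Setoid.ker C)) (s : ℕ) :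
    s * interInfo (partEnt μ) x y z
      ≤ s * (s + 1) / 2 * condInfo (partEnt μ) x (Setoid.ker C) y
        + condInfo (partEnt μ) y (Setoid.ker C) x := by
  have heven : ∀ m, EvenState Γ μ x y z (Setoid.ker C) m := fun m => by
    induction m with
    | zero => exact evenState_zero hμ C hxy
    | succ m ih => exact (ih.odd hμ1 hxy hzc).even hμ1 hxy hzc
  rcases Nat.even_or_odd' s with ⟨m, rfl | rfl⟩
  · obtain ⟨ν, hν, -, -, h⟩ := heven m
    have := (isPolymatroid_partEnt hν.nonneg (hν.sum_eq.trans hμ1)).condInfo_nonneg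
      (liftFst Γ y) (sndKer Ω Γ) (liftFst Γ x)
    push_cast
    linarith
  · obtain ⟨ν, hν, -, -, h⟩ := (heven m).odd hμ1 hxy hzc
    have := (isPolymatroid_partEnt hν.nonneg (hν.sum_eq.trans hμ1)).condInfo_nonneg
      (liftFst Γ (Setoid.ker C)) (sndKer Ω Γ) (liftFst Γ x)
    push_cast
    linarith

end Matus

section Triangle

variable {Ω SX SY SZ SA SB SC : Type*} [Fintype Ω]

lemma pr_comp {α β : Type*} [Fintype α] (μ : Ω → ℝ) (W : Ω → α) (g : α → β) (t : β) :
    pr μ (fun ω => g (W ω)) t = ∑ w, if g w = t then pr μ W w else 0 := by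
  have := sum_pr_mul μ W fun w => if g w = t then 1 else 0
  simp only [mul_ite, mul_one, mul_zero] at this
  exact this.symm

variable [Fintype SX] [Fintype SY] [Fintype SZ] [Fintype SA] [Fintype SB] [Fintype SC]

/-- A distribution that factorizes over the triangle causal structure satisfies the entropic
identity `IsTriangle`. -/
lemma isTriangle_of_factorization {μ : Ω → ℝ} (hμ : ∀ ω, 0 ≤ μ ω)
    (X : Ω → SX) (Y : Ω → SY) (Z : Ω → SZ) (A : Ω → SA) (B : Ω → SB) (C : Ω → SC)
    {pA : SA → ℝ} {pB : SB → ℝ} {pC : SC → ℝ}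
    {qX : SX → SB → SC → ℝ} {qY : SY → SA → SC → ℝ} {qZ : SZ → SA → SB → ℝ}
    (hpA : ∑ a, pA a = 1) (hpB : ∑ b, pB b = 1) (hpC : ∑ c, pC c = 1)
    (hqX : ∀ b c, ∑ x, qX x b c = 1) (hqY : ∀ a c, ∑ y, qY y a c = 1)
    (hqZ : ∀ a b, ∑ z, qZ z a b = 1)
    (hfact : ∀ x y z a b c,
      pr μ (fun ω => (X ω, Y ω, Z ω, A ω, B ω, C ω)) (x, y, z, a, b, c)
        = pA a * pB b * pC c * qX x b c * qY y a c * qZ z a b) :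
    IsTriangle (partEnt μ) (Setoid.ker X) (Setoid.ker Y) (Setoid.ker Z)
      (Setoid.ker A) (Setoid.ker B) (Setoid.ker C) := by
  let W : Ω → SA × SB × SC × SX × SY × SZ := fun ω => (A ω, B ω, C ω, X ω, Y ω, Z ω)
  have hW : ∀ a b c x y z, pr μ W (a, b, c, x, y, z)
      = pA a * (pB b * (pC c * (qX x b c * (qY y a c * qZ z a b)))) := fun a b c x y z => by
    have h := hfact x y z a b c
    have e : pr μ W (a, b, c, x, y, z)
        = pr μ (fun ω => (X ω, Y ω, Z ω, A ω, B ω, C ω)) (x, y, z, a, b, c) := by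
      refine Finset.sum_congr rfl fun ω _ => ?_
      congr 1
      simp only [W, Prod.mk.injEq, eq_iff_iff]
      tauto
    rw [e, h]
    ring
  have hA : ∀ a, pr μ A a = pA a := fun a => by
    refine (pr_comp μ W (fun w => w.1) a).trans ?_
    simp [Fintype.sum_prod_type, Finset.sum_ite_irrel, ← Finset.mul_sum, *]
  have hB : ∀ b, pr μ B b = pB b := fun b => by
    refine (pr_comp μ W (fun w => w.2.1) b).trans ?_
    simp [Fintype.sum_prod_type, Finset.sum_ite_irrel, ← Finset.mul_sum, ← Finset.sum_mul, *]
  have hC : ∀ c, pr μ C c = pC c := fun c => by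
    refine (pr_comp μ W (fun w => w.2.2.1) c).trans ?_
    simp [Fintype.sum_prod_type, Finset.sum_ite_irrel, ← Finset.mul_sum, ← Finset.sum_mul, *]
  have hBC : ∀ b c, pr μ (fun ω => (B ω, C ω)) (b, c) = pB b * pC c := fun b c => by
    refine (pr_comp μ W (fun w => (w.2.1, w.2.2.1)) (b, c)).trans ?_
    simp [Fintype.sum_prod_type, Finset.sum_ite_irrel, ite_and,
      ← Finset.mul_sum, ← Finset.sum_mul, *]
  have hAC : ∀ a c, pr μ (fun ω => (A ω, C ω)) (a, c) = pA a * pC c := fun a c => by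
    refine (pr_comp μ W (fun w => (w.1, w.2.2.1)) (a, c)).trans ?_
    simp [Fintype.sum_prod_type, Finset.sum_ite_irrel, ite_and,
      ← Finset.mul_sum, ← Finset.sum_mul, *]
  have hAB : ∀ a b, pr μ (fun ω => (A ω, B ω)) (a, b) = pA a * pB b := fun a b => by
    refine (pr_comp μ W (fun w => (w.1, w.2.1)) (a, b)).trans ?_
    simp [Fintype.sum_prod_type, Finset.sum_ite_irrel, ite_and, ← Finset.mul_sum, *]
  have hXBC : ∀ x b c, pr μ (fun ω => (X ω, B ω, C ω)) (x, b, c) = pB b * (pC c * qX x b c) :=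
    fun x b c => by
    refine (pr_comp μ W (fun w => (w.2.2.2.1, w.2.1, w.2.2.1)) (x, b, c)).trans ?_
    simp [Fintype.sum_prod_type, Finset.sum_ite_irrel, ite_and,
      ← Finset.mul_sum, ← Finset.sum_mul, *]
  have hYAC : ∀ y a c, pr μ (fun ω => (Y ω, A ω, C ω)) (y, a, c) = pA a * (pC c * qY y a c) :=
    fun y a c => by
    refine (pr_comp μ W (fun w => (w.2.2.2.2.1, w.1, w.2.2.1)) (y, a, c)).trans ?_
    simp [Fintype.sum_prod_type, Finset.sum_ite_irrel, ite_and,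
      ← Finset.mul_sum, ← Finset.sum_mul, *]
  have hZAB : ∀ z a b, pr μ (fun ω => (Z ω, A ω, B ω)) (z, a, b) = pA a * (pB b * qZ z a b) :=
    fun z a b => by
    refine (pr_comp μ W (fun w => (w.2.2.2.2.2, w.1, w.2.1)) (z, a, b)).trans ?_
    simp [Fintype.sum_prod_type, Finset.sum_ite_irrel, ite_and,
      ← Finset.mul_sum, ← Finset.sum_mul, *]
  unfold IsTriangle
  simp only [partEnt, ← Finset.sum_neg_distrib, ← Finset.sum_add_distrib]
  refine Finset.sum_congr rfl fun ω _ => ?_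
  by_cases h0 : μ ω = 0
  · simp [h0]
  have hpos := fun r => (classMass_pos hμ r h0).ne'
  have mA : classMass μ (Setoid.ker A) ω = pA (A ω) := hA (A ω)
  have mB : classMass μ (Setoid.ker B) ω = pB (B ω) := hB (B ω)
  have mC : classMass μ (Setoid.ker C) ω = pC (C ω) := hC (C ω)
  have mBC : classMass μ (Setoid.ker B ⊓ Setoid.ker C) ω = pB (B ω) * pC (C ω) := by
    rw [← hBC, ← ker_prodMk]; rfl
  have mAC : classMass μ (Setoid.ker A ⊓ Setoid.ker C) ω = pA (A ω) * pC (C ω) := by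
    rw [← hAC, ← ker_prodMk]; rfl
  have mAB : classMass μ (Setoid.ker A ⊓ Setoid.ker B) ω = pA (A ω) * pB (B ω) := by
    rw [← hAB, ← ker_prodMk]; rfl
  have mXBC : classMass μ (Setoid.ker X ⊓ Setoid.ker B ⊓ Setoid.ker C) ω
      = pB (B ω) * (pC (C ω) * qX (X ω) (B ω) (C ω)) := by
    rw [← hXBC, inf_assoc, ← ker_prodMk, ← ker_prodMk]; rfl
  have mYAC : classMass μ (Setoid.ker Y ⊓ Setoid.ker A ⊓ Setoid.ker C) ω
      = pA (A ω) * (pC (C ω) * qY (Y ω) (A ω) (C ω)) := by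
    rw [← hYAC, inf_assoc, ← ker_prodMk, ← ker_prodMk]; rfl
  have mZAB : classMass μ (Setoid.ker Z ⊓ Setoid.ker A ⊓ Setoid.ker B) ω
      = pA (A ω) * (pB (B ω) * qZ (Z ω) (A ω) (B ω)) := by
    rw [← hZAB, inf_assoc, ← ker_prodMk, ← ker_prodMk]; rfl
  have mW : classMass μ (Setoid.ker X ⊓ Setoid.ker Y ⊓ Setoid.ker Z ⊓ Setoid.ker A ⊓ Setoid.ker B
      ⊓ Setoid.ker C) ω = pA (A ω) * pB (B ω) * pC (C ω) * qX (X ω) (B ω) (C ω)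
        * qY (Y ω) (A ω) (C ω) * qZ (Z ω) (A ω) (B ω) := by
    rw [← hfact]
    simp only [inf_assoc]
    simp only [← ker_prodMk]
    rfl
  have key : Real.log (classMass μ (Setoid.ker X ⊓ Setoid.ker Y ⊓ Setoid.ker Z ⊓ Setoid.ker A
        ⊓ Setoid.ker B ⊓ Setoid.ker C) ω * classMass μ (Setoid.ker B ⊓ Setoid.ker C) ω
        * classMass μ (Setoid.ker A ⊓ Setoid.ker C) ω
        * classMass μ (Setoid.ker A ⊓ Setoid.ker B) ω)
      = Real.log (classMass μ (Setoid.ker A) ω * classMass μ (Setoid.ker B) ω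
        * classMass μ (Setoid.ker C) ω
        * classMass μ (Setoid.ker X ⊓ Setoid.ker B ⊓ Setoid.ker C) ω
        * classMass μ (Setoid.ker Y ⊓ Setoid.ker A ⊓ Setoid.ker C) ω
        * classMass μ (Setoid.ker Z ⊓ Setoid.ker A ⊓ Setoid.ker B) ω) := by
    rw [mA, mB, mC, mBC, mAC, mAB, mXBC, mYAC, mZAB, mW]
    ring_nf
  simp only [ne_eq, mul_eq_zero, hpos, or_self, not_false_eq_true, Real.log_mul] at key
  linear_combination -μ ω * key

lemma matusMarg2_of_isTriangle {μ : Ω → ℝ} (hμ : ∀ ω, 0 ≤ μ ω) (hμ1 : ∑ ω, μ ω = 1)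
    {P : Ω → SX} {Q : Ω → SY} {R : Ω → SZ} {a b : Setoid Ω} {C : Ω → SC}
    (h : IsTriangle (partEnt μ) (Setoid.ker P) (Setoid.ker Q) (Setoid.ker R) a b (Setoid.ker C))
    {s : ℕ} (hs : 1 ≤ s) : matusMarg2 (s : ℝ) μ P Q R := by
  have hf := isPolymatroid_partEnt hμ hμ1
  have := h.marginal_of_matus hf (s := s) (by exact_mod_cast hs)
    (matus_inequality hμ hμ1 C (h.condInfo_eq_zero hf) (h.indep hf) s)
  simpa only [matusMarg2, ent_eq_partEnt, ker_prodMk, ← inf_assoc] using this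

end Triangle

/-- **Proposition 4, family (15).** For every distribution compatible with the classical
triangle causal structure and every integer `s ≥ 1`, the inequality `matusMarg2` holds
for `(X, Y, Z)` and all permutations of the roles of `X`, `Y` and `Z`. -/
theorem triangle_matus_marg2
    {Ω SX SY SZ SA SB SC : Type*} [Fintype Ω] [Fintype SX] [Fintype SY] [Fintype SZ]
    [Fintype SA] [Fintype SB] [Fintype SC]
    (μ : Ω → ℝ) (hμ0 : ∀ ω, 0 ≤ μ ω) (hμ1 : ∑ ω, μ ω = 1)
    (X : Ω → SX) (Y : Ω → SY) (Z : Ω → SZ) (A : Ω → SA) (B : Ω → SB) (C : Ω → SC)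
    (pA : SA → ℝ) (pB : SB → ℝ) (pC : SC → ℝ)
    (qX : SX → SB → SC → ℝ) (qY : SY → SA → SC → ℝ) (qZ : SZ → SA → SB → ℝ)
    (hpA0 : ∀ a, 0 ≤ pA a) (hpA1 : ∑ a, pA a = 1)
    (hpB0 : ∀ b, 0 ≤ pB b) (hpB1 : ∑ b, pB b = 1)
    (hpC0 : ∀ c, 0 ≤ pC c) (hpC1 : ∑ c, pC c = 1)
    (hqX0 : ∀ x b c, 0 ≤ qX x b c) (hqX1 : ∀ b c, ∑ x, qX x b c = 1)
    (hqY0 : ∀ y a c, 0 ≤ qY y a c) (hqY1 : ∀ a c, ∑ y, qY y a c = 1)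
    (hqZ0 : ∀ z a b, 0 ≤ qZ z a b) (hqZ1 : ∀ a b, ∑ z, qZ z a b = 1)
    (hfact : ∀ x y z a b c,
      pr μ (fun ω => (X ω, Y ω, Z ω, A ω, B ω, C ω)) (x, y, z, a, b, c)
        = pA a * pB b * pC c * qX x b c * qY y a c * qZ z a b)
    (s : ℕ) (hs : 1 ≤ s) :
    matusMarg2 (s : ℝ) μ X Y Z ∧ matusMarg2 (s : ℝ) μ X Z Y ∧
    matusMarg2 (s : ℝ) μ Y X Z ∧ matusMarg2 (s : ℝ) μ Y Z X ∧
    matusMarg2 (s : ℝ) μ Z X Y ∧ matusMarg2 (s : ℝ) μ Z Y X := by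
  have h := isTriangle_of_factorization hμ0 X Y Z A B C hpA1 hpB1 hpC1 hqX1 hqY1 hqZ1 hfact
  exact ⟨matusMarg2_of_isTriangle hμ0 hμ1 h hs,
    matusMarg2_of_isTriangle hμ0 hμ1 h.swap_yz hs,
    matusMarg2_of_isTriangle hμ0 hμ1 h.swap_xy hs,
    matusMarg2_of_isTriangle hμ0 hμ1 h.swap_xy.swap_yz hs,
    matusMarg2_of_isTriangle hμ0 hμ1 h.swap_yz.swap_xy hs,
    matusMarg2_of_isTriangle hμ0 hμ1 h.swap_yz.swap_xy.swap_yz hs⟩
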